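/- For ω ∈ L ∖ K_∞ put Λ_ω := A·ω + A (an A-lattice of rank 2 in L) and Δ(ω) := T·(∏_w e^{Λ_ω}(w))^{−1}, the product over a set of representatives w of the nonzero classes of (T^{−1}Λ_ω)/Λ_ω (the value being independent of the choice). Then for every monic irreducible polynomial n ∈ A of degree d with n ≠ T, the functional equation Δ(ω)^{q^d + 1} = Δ(nω) · ∏_{a ∈ A, deg a < d} Δ((ω + a)/n) holds. -/

import Mathlib

open scoped Classical

noncomputable section

variable {Fq : Type*} [Field Fq] [Fintype Fq]
variable {L : Type*} [NormedField L] [CompleteSpace L]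
variable [Algebra (Polynomial Fq) L]

/-- `log_q |z|`. -/
def logq (q : ℕ) (z : L) : ℝ := Real.logb q ‖z‖

/-- An `A = 𝔽_q[T]`-lattice of rank `r` in `L`: a finitely generated `A`-submodule which is
free of rank `r` (equivalently: its `𝔽_q(T)`-span has dimension `r`), and which is
discrete in `L` (finite intersection with every bounded ball). -/
def IsLatticeOfRank (r : ℕ) (Λ : Submodule (Polynomial Fq) L) : Prop :=
  (∃ b : Fin r → L, LinearIndependent (Polynomial Fq) b ∧
      Submodule.span (Polynomial Fq) (Set.range b) = Λ) ∧
  ∀ B : ℝ, {x : L | x ∈ Λ ∧ ‖x‖ ≤ B}.Finite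

/-- Membership in `K·Λ`, the `K = 𝔽_q(T)`-span of `Λ` in `L`. -/
def InKSpan (Λ : Submodule (Polynomial Fq) L) (u : L) : Prop :=
  ∃ n : Polynomial Fq, n ≠ 0 ∧ n • u ∈ Λ

/-- The exponential function of the lattice `Λ`: `e^Λ(z) = z·∏_{0≠λ∈Λ} (1 - z/λ)`. -/
def latExp (Λ : Submodule (Polynomial Fq) L) (z : L) : L :=
  z * ∏' l : {x : L // x ∈ Λ ∧ x ≠ 0}, (1 - z / (l : L))

/-- `R` is a complete set of representatives for the classes of `Λ'` modulo `Λ`. -/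
def IsRepSet (Λ Λ' : Submodule (Polynomial Fq) L) (R : Finset L) : Prop :=
  (∀ w ∈ R, w ∈ Λ') ∧ ∀ y ∈ Λ', ∃! w, w ∈ R ∧ y - w ∈ Λ

/-- The discriminant `Δ^{Λ'|Λ} := (∏_{0 ≠ w ∈ Λ'/Λ} e^Λ(w))⁻¹`, computed via a choice of a
complete set of representatives containing `0` (the value is independent of this choice). -/
def latDisc (Λ Λ' : Submodule (Polynomial Fq) L) : L :=
  if h : ∃ R : Finset L, IsRepSet Λ Λ' R ∧ (0 : L) ∈ R then
    (∏ w ∈ h.choose.erase 0, latExp Λ w)⁻¹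
  else 1

/-- The scaled lattice `c·Λ`. -/
def scaleSub (c : L) (Λ : Submodule (Polynomial Fq) L) : Submodule (Polynomial Fq) L :=
  Submodule.map (LinearMap.mulLeft (Polynomial Fq) c) Λ

/-- `K_∞ ⊆ L`: the closure in `L` of the subfield `𝔽_q(T)` generated by the image of
`A = 𝔽_q[T]`; since `|·|` restricts to the `∞`-adic absolute value on `𝔽_q(T)`, this is a
copy of the completion `K_∞ = 𝔽_q((T⁻¹))`. -/
def Kinfty : Set L :=
  closure ((Subfield.closure (Set.range (algebraMap (Polynomial Fq) L)) : Subfield L) : Set L)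

/-- The rank-2 lattice `Λ_ω = A·ω + A`. -/
def lat2 (ω : L) : Submodule (Polynomial Fq) L :=
  Submodule.span (Polynomial Fq) {ω, (1 : L)}

/-- The discriminant `Δ(ω) = T·(∏_{0≠w ∈ (T⁻¹Λ_ω)/Λ_ω} e^{Λ_ω}(w))⁻¹`. -/
def Dfun (ω : L) : L :=
  algebraMap (Polynomial Fq) L Polynomial.X *
    latDisc (lat2 (Fq := Fq) ω)
      (scaleSub (algebraMap (Polynomial Fq) L Polynomial.X)⁻¹ (lat2 (Fq := Fq) ω))

section Products

variable {M : Type*} [NormedField M]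

theorem exists_finset_norm_sub_one_le {ι : Type*} {f : ι → M}
    (hf : Filter.Tendsto f Filter.cofinite (nhds 1)) {ε : ℝ} (hε : 0 < ε) :
    ∃ s : Finset ι, ∀ i ∉ s, ‖f i - 1‖ ≤ ε := by
  have h := (Metric.tendsto_nhds.1 hf) ε hε
  rw [Filter.eventually_cofinite] at h
  refine ⟨h.toFinset, fun i hi => ?_⟩
  rw [Set.Finite.mem_toFinset, Set.mem_ofPred_eq, not_not, dist_eq_norm] at hi
  exact hi.le

/-- A subset of a normed field meeting every ball around `0` in a finite set. -/
def LocFinite (S : Set M) : Prop :=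
  ∀ B : ℝ, {x : M | x ∈ S ∧ ‖x‖ ≤ B}.Finite

/-- The canonical product `∏ (1 - z / x)` over the elements `x` of `S`; a factor with `x = 0`
is equal to `1`. -/
def canonProd (S : Set M) (z : M) : M :=
  ∏' x : S, (1 - z / (x : M))

theorem LocFinite.mono {S S' : Set M} (h : LocFinite S') (hS : S ⊆ S') : LocFinite S :=
  fun B => (h B).subset fun _ hx => ⟨hS hx.1, hx.2⟩

theorem LocFinite.of_mul_left {S S' : Set M} (h : LocFinite S') {c : M} (hc : c ≠ 0)
    (hS : ∀ x ∈ S, c * x ∈ S') : LocFinite S := by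
  intro B
  refine Set.Finite.of_finite_image ((h (‖c‖ * B)).subset ?_) (mul_right_injective₀ hc).injOn
  rintro _ ⟨x, hx, rfl⟩
  refine ⟨hS x hx.1, ?_⟩
  have := hx.2
  simp only [norm_mul]
  gcongr

theorem LocFinite.tendsto {S : Set M} (h : LocFinite S) (z : M) :
    Filter.Tendsto (fun x : S => 1 - z / (x : M)) Filter.cofinite (nhds 1) := by
  rw [Metric.tendsto_nhds]
  intro ε hε
  rw [Filter.eventually_cofinite]
  refine Set.Finite.of_finite_image ((h (‖z‖ / ε)).subset ?_) Subtype.val_injective.injOn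
  rintro _ ⟨x, hx, rfl⟩
  refine ⟨x.2, ?_⟩
  simp only [dist_eq_norm, Set.mem_ofPred_eq, not_lt] at hx
  rw [show 1 - z / (x : M) - 1 = -(z / x) by ring, norm_neg, norm_div] at hx
  have hx0 : 0 < ‖(x : M)‖ := by
    by_contra hneg
    have : ‖(x : M)‖ = 0 := le_antisymm (not_lt.1 hneg) (norm_nonneg _)
    rw [this, div_zero] at hx
    linarith
  rw [le_div_iff₀ hx0] at hx
  rw [le_div_iff₀ hε]
  linarith

theorem canonProd_smul (S S' : Set M) {c : M} (hc : c ≠ 0)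
    (hS : ∀ x, x ∈ S ↔ c * x ∈ S') (z : M) : canonProd S' (c * z) = canonProd S z := by
  let e : S ≃ S' := (Equiv.mulLeft₀ c hc).subtypeEquiv hS
  refine (e.tprod_eq _).symm.trans (tprod_congr fun x => ?_)
  change 1 - c * z / (c * (x : M)) = _
  rw [mul_div_mul_left _ _ hc]

variable [IsUltrametricDist M]

theorem norm_prod_sub_one_le {ι : Type*} {f : ι → M} {ε : ℝ} (hε : 0 ≤ ε) (hε1 : ε ≤ 1)
    (s : Finset ι) (h : ∀ i ∈ s, ‖f i - 1‖ ≤ ε) : ‖∏ i ∈ s, f i - 1‖ ≤ ε := by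
  induction s using Finset.induction_on with
  | empty => simpa using hε
  | insert a s ha ih =>
    rw [Finset.prod_insert ha]
    have h1 := h a (Finset.mem_insert_self a s)
    have h2 := ih fun i hi => h i (Finset.mem_insert_of_mem hi)
    have h3 : ‖f a‖ ≤ 1 := by
      have := IsUltrametricDist.norm_add_le_max (f a - 1) 1
      rw [sub_add_cancel, norm_one] at this
      exact this.trans (max_le (h1.trans hε1) le_rfl)
    have h4 : f a * ∏ i ∈ s, f i - 1 = f a * (∏ i ∈ s, f i - 1) + (f a - 1) := by ring
    rw [h4]
    refine (IsUltrametricDist.norm_add_le_max _ _).trans (max_le ?_ h1)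
    rw [norm_mul]
    exact (mul_le_of_le_one_left (norm_nonneg _) h3).trans h2

theorem norm_prod_le_one_of_norm_sub_one_le {ι : Type*} {f : ι → M}
    (s : Finset ι) (h : ∀ i ∈ s, ‖f i - 1‖ ≤ 1) : ‖∏ i ∈ s, f i‖ ≤ 1 := by
  have := IsUltrametricDist.norm_add_le_max (∏ i ∈ s, f i - 1) 1
  rw [sub_add_cancel, norm_one] at this
  exact this.trans (max_le (norm_prod_sub_one_le zero_le_one le_rfl s h) le_rfl)

theorem multipliable_of_tendsto_cofinite_nhds_one [CompleteSpace M] {ι : Type*} {f : ι → M}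
    (hf : Filter.Tendsto f Filter.cofinite (nhds 1)) : Multipliable f := by
  obtain ⟨s₁, hs₁⟩ := exists_finset_norm_sub_one_le hf one_pos
  have hcauchy : CauchySeq fun s : Finset ι => ∏ i ∈ s, f i := by
    rw [Metric.cauchySeq_iff']
    intro ε hε
    set C := ‖∏ i ∈ s₁, f i‖ with hC
    have hC0 : 0 < C + 1 := by positivity
    set δ := min 1 (ε / (C + 1)) with hδ
    have hδ0 : 0 < δ := lt_min one_pos (by positivity)
    obtain ⟨s₂, hs₂⟩ := exists_finset_norm_sub_one_le hf hδ0
    refine ⟨s₁ ∪ s₂, fun t ht => ?_⟩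
    have hbound : ‖∏ i ∈ s₁ ∪ s₂, f i‖ ≤ C := by
      rw [← Finset.prod_sdiff (Finset.subset_union_left : s₁ ⊆ s₁ ∪ s₂), norm_mul]
      refine mul_le_of_le_one_left (norm_nonneg _)
        (norm_prod_le_one_of_norm_sub_one_le _ fun i hi => hs₁ i (Finset.mem_sdiff.1 hi).2)
    rw [← Finset.prod_sdiff ht, dist_eq_norm, ← sub_one_mul, norm_mul]
    have h1 : ‖∏ i ∈ t \ (s₁ ∪ s₂), f i - 1‖ ≤ δ :=
      norm_prod_sub_one_le hδ0.le (min_le_left _ _) _ fun i hi =>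
        hs₂ i fun h => (Finset.mem_sdiff.1 hi).2 (Finset.mem_union_right _ h)
    calc _ ≤ δ * C := mul_le_mul h1 hbound (norm_nonneg _) hδ0.le
      _ < δ * (C + 1) := by nlinarith
      _ ≤ ε / (C + 1) * (C + 1) := by gcongr; exact min_le_right _ _
      _ = ε := by field_simp
  exact cauchySeq_tendsto_of_complete hcauchy

theorem tprod_ne_zero_of_tendsto_cofinite_nhds_one [CompleteSpace M] {ι : Type*} {f : ι → M}
    (hf : Filter.Tendsto f Filter.cofinite (nhds 1)) (h0 : ∀ i, f i ≠ 0) : ∏' i, f i ≠ 0 := by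
  obtain ⟨s₁, hs₁⟩ := exists_finset_norm_sub_one_le hf (half_pos (one_pos : (0 : ℝ) < 1))
  have hlim : Filter.Tendsto (fun s : Finset ι => ‖∏ i ∈ s, f i‖) Filter.atTop
      (nhds ‖∏' i, f i‖) :=
    Filter.Tendsto.norm (multipliable_of_tendsto_cofinite_nhds_one hf).hasProd
  have hge : ‖∏ i ∈ s₁, f i‖ * (1 / 2) ≤ ‖∏' i, f i‖ := by
    refine ge_of_tendsto hlim ?_
    filter_upwards [Filter.eventually_ge_atTop s₁] with t ht
    rw [← Finset.prod_sdiff ht, norm_mul, mul_comm]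
    gcongr
    have h1 : ‖∏ i ∈ t \ s₁, f i - 1‖ ≤ 1 / 2 :=
      norm_prod_sub_one_le (by norm_num) (by norm_num) _ fun i hi =>
        hs₁ i (Finset.mem_sdiff.1 hi).2
    have h2 := norm_sub_norm_le (1 : M) (∏ i ∈ t \ s₁, f i)
    rw [norm_sub_rev, norm_one] at h2
    linarith
  have hpos : 0 < ‖∏ i ∈ s₁, f i‖ := norm_pos_iff.2 (Finset.prod_ne_zero_iff.2 fun i _ => h0 i)
  exact norm_pos_iff.1 (lt_of_lt_of_le (by positivity) hge)

variable [CompleteSpace M]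

theorem LocFinite.multipliable {S : Set M} (h : LocFinite S) (z : M) :
    Multipliable fun x : S => 1 - z / (x : M) :=
  multipliable_of_tendsto_cofinite_nhds_one (h.tendsto z)

theorem canonProd_ne_zero {S : Set M} (h : LocFinite S) {z : M} (hz : z ∉ S) :
    canonProd S z ≠ 0 := by
  refine tprod_ne_zero_of_tendsto_cofinite_nhds_one (h.tendsto z) fun x hx => ?_
  by_cases hx0 : (x : M) = 0
  · simp [hx0] at hx
  · rw [sub_eq_zero, eq_div_iff hx0, one_mul] at hx
    exact hz (hx ▸ x.2)

theorem canonProd_union {S S' : Set M} (h : LocFinite S) (h' : LocFinite S')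
    (hd : Disjoint S S') (z : M) :
    canonProd (S ∪ S') z = canonProd S z * canonProd S' z :=
  (HasProd.mul_disjoint (f := fun x : M => 1 - z / x) hd (h.multipliable z).hasProd
    (h'.multipliable z).hasProd).tprod_eq

theorem canonProd_biUnion {ι : Type*} (s : Finset ι) {S : ι → Set M}
    (h : ∀ i ∈ s, LocFinite (S i)) (hd : (s : Set ι).PairwiseDisjoint S) (z : M) :
    canonProd (⋃ i ∈ s, S i) z = ∏ i ∈ s, canonProd (S i) z :=
  (hasProd_prod_disjoint (f := fun x : M => 1 - z / x) s hd
    fun i hi => ((h i hi).multipliable z).hasProd).tprod_eq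

theorem canonProd_add_invariant {S : Set M} (h : LocFinite S) (h0 : (0 : M) ∉ S) {m : M}
    (hm : ∀ x, x ∈ S ↔ x + m ∈ S) : canonProd S (-m) = 1 := by
  have hlim : Filter.Tendsto (fun s : Finset S => ∏ x ∈ s, (1 - -m / (x : M))) Filter.atTop
      (nhds (canonProd S (-m))) := (h.multipliable (-m)).hasProd
  refine (isClosed_singleton (x := (1 : M))).mem_of_frequently_of_tendsto ?_ hlim
  rw [Filter.frequently_atTop]
  intro s
  obtain ⟨B, hmB, hsB⟩ : ∃ B : ℝ, ‖m‖ ≤ B ∧ ∀ x ∈ s, ‖(x : M)‖ ≤ B := by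
    refine ⟨‖m‖ + ∑ x ∈ s, ‖(x : M)‖, ?_, fun x hx => ?_⟩
    · have : 0 ≤ ∑ x ∈ s, ‖(x : M)‖ := Finset.sum_nonneg fun _ _ => norm_nonneg _
      linarith
    · have : ‖(x : M)‖ ≤ ∑ x ∈ s, ‖(x : M)‖ :=
        Finset.single_le_sum (f := fun x : S => ‖(x : M)‖) (fun _ _ => norm_nonneg _) hx
      have := norm_nonneg m
      linarith
  have hfin : {x : S | ‖(x : M)‖ ≤ B}.Finite := by
    refine Set.Finite.of_finite_image ((h B).subset ?_) Subtype.val_injective.injOn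
    rintro _ ⟨x, hx, rfl⟩
    exact ⟨x.2, hx⟩
  refine ⟨hfin.toFinset, fun x hx => by simpa using hsB x hx, ?_⟩
  have hne : ∀ x : S, (x : M) ≠ 0 := fun x hx => h0 (hx ▸ x.2)
  have hprod : ∏ x ∈ hfin.toFinset, ((x : M) + m) = ∏ x ∈ hfin.toFinset, (x : M) := by
    let e : S ≃ S := (Equiv.addRight m).subtypeEquiv hm
    have he : ∀ x : S, (e x : M) = x + m := fun x => rfl
    refine Finset.prod_equiv e (fun x => ?_) fun x _ => (he x).symm
    simp only [Set.Finite.mem_toFinset, Set.mem_ofPred_eq, he]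
    constructor
    · exact fun hx => (IsUltrametricDist.norm_add_le_max _ _).trans (max_le hx hmB)
    · intro hx
      have := IsUltrametricDist.norm_add_le_max ((x : M) + m) (-m)
      rw [add_neg_cancel_right, norm_neg] at this
      exact this.trans (max_le hx hmB)
  have : ∀ x ∈ hfin.toFinset, 1 - -m / (x : M) = ((x : M) + m) / x := fun x _ => by
    have := hne x
    field_simp
    ring
  rw [Finset.prod_congr rfl this, Finset.prod_div_distrib, hprod, div_self]
  · exact Set.mem_singleton _
  · exact Finset.prod_ne_zero_iff.2 fun x _ => hne x

end Products
theorem Submodule.mem_of_isCoprime_smul {R V : Type*} [CommRing R] [AddCommGroup V] [Module R V]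
    {N : Submodule R V} {a b : R} (hab : IsCoprime a b) {x : V} (ha : a • x ∈ N)
    (hb : b • x ∈ N) : x ∈ N := by
  obtain ⟨u, v, huv⟩ := hab
  rw [← one_smul R x, ← huv, add_smul, mul_smul, mul_smul]
  exact N.add_mem (N.smul_mem u ha) (N.smul_mem v hb)

theorem prod_erase_image_mul_left {L : Type*} [Field L] {c : L} (hc : c ≠ 0) (R : Finset L)
    (f : L → L) :
    ∏ w ∈ (R.image (c * ·)).erase 0, f w = ∏ w ∈ R.erase 0, f (c * w) := by
  have hinj : Function.Injective (c * · : L → L) := mul_right_injective₀ hc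
  have : (R.image (c * ·)).erase 0 = (R.erase 0).image (c * ·) := by
    rw [Finset.image_erase hinj, mul_zero]
  rw [this, Finset.prod_image hinj.injOn]

section Lattices

variable {F : Type*} [Field F] {M : Type*} [NormedField M] [Algebra (Polynomial F) M]
  {Λ Λ' : Submodule (Polynomial F) M} {n t : Polynomial F}

theorem IsRepSet.notMem_of_mem_erase {R : Finset M} (h : IsRepSet Λ Λ' R)
    (h0 : (0 : M) ∈ R) {w : M} (hw : w ∈ R.erase 0) : w ∉ Λ := fun hwΛ =>
  Finset.ne_of_mem_erase hw <| (h.2 w (h.1 w (Finset.mem_of_mem_erase hw))).unique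
    ⟨Finset.mem_of_mem_erase hw, by simp⟩ ⟨h0, by simpa using hwΛ⟩

theorem IsRepSet.eq_of_sub_mem {R : Finset M} (h : IsRepSet Λ Λ' R) {w w' : M}
    (hw : w ∈ R) (hw' : w' ∈ R) (hsub : w - w' ∈ Λ) : w = w' :=
  (h.2 w (h.1 w hw)).unique ⟨hw, by simp⟩ ⟨hw', hsub⟩

theorem mem_scaleSub_inv {a : Polynomial F} (ha : algebraMap (Polynomial F) M a ≠ 0) {x : M} :
    x ∈ scaleSub (algebraMap (Polynomial F) M a)⁻¹ Λ ↔ a • x ∈ Λ := by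
  rw [scaleSub, Submodule.mem_map, Algebra.smul_def]
  constructor
  · rintro ⟨y, hy, rfl⟩
    rwa [LinearMap.mulLeft_apply, mul_inv_cancel_left₀ ha]
  · exact fun h => ⟨_, h, by rw [LinearMap.mulLeft_apply, inv_mul_cancel_left₀ ha]⟩

theorem IsRepSet.image_mul_left {Γ Γ' : Submodule (Polynomial F) M} {R : Finset M}
    (h : IsRepSet Λ Λ' R) {c : M} (hc : c ≠ 0) (hΓ : ∀ x, x ∈ Λ ↔ c * x ∈ Γ)
    (hΓ' : ∀ x, x ∈ Λ' ↔ c * x ∈ Γ') : IsRepSet Γ Γ' (R.image (c * ·)) := by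
  refine ⟨fun w hw => ?_, fun y hy => ?_⟩
  · obtain ⟨v, hv, rfl⟩ := Finset.mem_image.1 hw
    exact (hΓ' v).1 (h.1 v hv)
  · have hy' : c⁻¹ * y ∈ Λ' := by rwa [hΓ', mul_inv_cancel_left₀ hc]
    have hmem : ∀ v, c⁻¹ * y - v ∈ Λ ↔ y - c * v ∈ Γ := fun v => by
      rw [hΓ, mul_sub, mul_inv_cancel_left₀ hc]
    obtain ⟨v, ⟨hv, hs⟩, huniq⟩ := h.2 _ hy'
    refine ⟨c * v, ⟨Finset.mem_image_of_mem _ hv, (hmem v).1 hs⟩, ?_⟩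
    rintro _ ⟨hw, hws⟩
    obtain ⟨v', hv', rfl⟩ := Finset.mem_image.1 hw
    rw [huniq v' ⟨hv', (hmem v').2 hws⟩]

theorem IsRepSet.of_le_of_smul_mem (hnt : IsCoprime n t)
    (ht : algebraMap (Polynomial F) M t ≠ 0) {R : Finset M}
    (h : IsRepSet Λ (scaleSub (algebraMap (Polynomial F) M t)⁻¹ Λ) R)
    (hle : Λ ≤ Λ') (hn : ∀ x ∈ Λ', n • x ∈ Λ) :
    IsRepSet Λ' (scaleSub (algebraMap (Polynomial F) M t)⁻¹ Λ') R := by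
  have hR : ∀ w ∈ R, t • w ∈ Λ := fun w hw => (mem_scaleSub_inv ht).1 (h.1 w hw)
  refine ⟨fun w hw => (mem_scaleSub_inv ht).2 (hle (hR w hw)), fun y hy => ?_⟩
  rw [mem_scaleSub_inv ht] at hy
  obtain ⟨u, v, huv⟩ := hnt
  have hmem : (u * n) • y ∈ scaleSub (algebraMap (Polynomial F) M t)⁻¹ Λ := by
    rw [mem_scaleSub_inv ht, smul_smul, show t * (u * n) = u * (n * t) by ring, mul_smul, mul_smul]
    exact Λ.smul_mem u (hn _ hy)
  obtain ⟨w, ⟨hw, hs⟩, -⟩ := h.2 _ hmem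
  have hyw : y - w ∈ Λ' := by
    have : y - w = ((u * n) • y - w) + v • t • y := by
      rw [smul_smul, sub_add_eq_add_sub, ← add_smul, huv, one_smul]
    rw [this]
    exact Λ'.add_mem (hle hs) (Λ'.smul_mem v hy)
  refine ⟨w, ⟨hw, hyw⟩, fun w' ⟨hw', hs'⟩ => h.eq_of_sub_mem hw' hw ?_⟩
  refine Submodule.mem_of_isCoprime_smul ⟨u, v, huv⟩ (hn _ ?_) ?_
  · have := Λ'.sub_mem hyw hs'
    rwa [sub_sub_sub_cancel_left] at this
  · rw [smul_sub]
    exact Λ.sub_mem (hR _ hw') (hR _ hw)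

theorem IsRepSet.image_smul (hnt : IsCoprime n t)
    (ht : algebraMap (Polynomial F) M t ≠ 0) {R : Finset M}
    (h : IsRepSet Λ (scaleSub (algebraMap (Polynomial F) M t)⁻¹ Λ) R) :
    IsRepSet Λ (scaleSub (algebraMap (Polynomial F) M t)⁻¹ Λ)
      (R.image (algebraMap (Polynomial F) M n * ·)) := by
  have hR : ∀ w ∈ R, t • w ∈ Λ := fun w hw => (mem_scaleSub_inv ht).1 (h.1 w hw)
  refine ⟨fun w hw => ?_, fun y hy => ?_⟩
  · obtain ⟨v, hv, rfl⟩ := Finset.mem_image.1 hw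
    rw [mem_scaleSub_inv ht, ← Algebra.smul_def, smul_comm]
    exact Λ.smul_mem n (hR v hv)
  · have hy' := (mem_scaleSub_inv ht).1 hy
    obtain ⟨u, v, huv⟩ := hnt
    obtain ⟨w, ⟨hw, hs⟩, -⟩ := h.2 _ (Submodule.smul_mem _ u hy)
    have hyw : y - n • w ∈ Λ := by
      have : y - n • w = n • (u • y - w) + v • t • y := by
        rw [smul_sub, smul_smul, smul_smul, mul_comm n u, sub_add_eq_add_sub, ← add_smul, huv,
          one_smul]
      rw [this]
      exact Λ.add_mem (Λ.smul_mem n hs) (Λ.smul_mem v hy')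
    refine ⟨algebraMap (Polynomial F) M n * w, ⟨Finset.mem_image_of_mem _ hw, ?_⟩, ?_⟩
    · rwa [← Algebra.smul_def]
    · rintro _ ⟨hw', hs'⟩
      obtain ⟨w', hv', rfl⟩ := Finset.mem_image.1 hw'
      rw [← Algebra.smul_def] at hs'
      refine congrArg _ (h.eq_of_sub_mem hv' hw ?_)
      refine Submodule.mem_of_isCoprime_smul ⟨u, v, huv⟩ ?_ ?_
      · have := Λ.sub_mem hyw hs'
        rwa [sub_sub_sub_cancel_left, ← smul_sub] at this
      · rw [smul_sub]
        exact Λ.sub_mem (hR _ hv') (hR _ hw)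

theorem latExp_eq_mul_canonProd (Λ : Submodule (Polynomial F) M) (z : M) :
    latExp Λ z = z * canonProd {x : M | x ∈ Λ ∧ x ≠ 0} z := rfl

theorem latExp_mul_left {c : M} (hc : c ≠ 0) (h : ∀ x, x ∈ Λ ↔ c * x ∈ Λ') (z : M) :
    latExp Λ' (c * z) = c * latExp Λ z := by
  rw [latExp_eq_mul_canonProd, latExp_eq_mul_canonProd, mul_assoc,
    canonProd_smul {x : M | x ∈ Λ ∧ x ≠ 0} {x : M | x ∈ Λ' ∧ x ≠ 0} hc]
  intro x
  simp [h x, hc]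

theorem LocFinite.coset (hΛ : LocFinite (Λ : Set M)) (u : M) :
    LocFinite {x : M | x - u ∈ Λ} := by
  intro B
  refine Set.Finite.of_finite_image ((hΛ (B + ‖u‖)).subset ?_) (sub_left_injective (b := u)).injOn
  rintro _ ⟨x, hx, rfl⟩
  exact ⟨hx.1, (norm_sub_le _ _).trans (by have := hx.2; gcongr)⟩

variable [IsUltrametricDist M] [CompleteSpace M]

theorem latExp_ne_zero (hΛ : LocFinite (Λ : Set M)) {z : M} (hz : z ∉ Λ) : latExp Λ z ≠ 0 :=
  mul_ne_zero (fun h => hz (h ▸ Λ.zero_mem))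
    (canonProd_ne_zero (hΛ.mono fun _ hx => hx.1) fun h => hz h.1)

theorem latExp_eq_mul_of_le (h : Λ ≤ Λ') (hΛ' : LocFinite (Λ' : Set M)) (z : M) :
    latExp Λ' z = latExp Λ z * canonProd ((Λ' : Set M) \ Λ) z := by
  rw [latExp_eq_mul_canonProd, latExp_eq_mul_canonProd, mul_assoc, ← canonProd_union]
  · congr 2
    ext x
    simp only [Set.mem_ofPred_eq, Set.mem_union, Set.mem_sdiff, SetLike.mem_coe]
    by_cases hx : x ∈ Λ
    · simp [hx, h hx]
    · have : x ≠ 0 := fun h0 => hx (h0 ▸ Λ.zero_mem)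
      simp [hx, this]
  · exact hΛ'.mono fun x hx => h hx.1
  · exact hΛ'.mono fun x hx => hx.1
  · exact Set.disjoint_left.2 fun x hx hx' => hx'.2 hx.1

theorem latExp_sub (hΛ : LocFinite (Λ : Set M)) {u : M} (hu : u ∉ Λ) (w : M) :
    latExp Λ (u - w) = latExp Λ u * canonProd {x : M | x - u ∈ Λ} w := by
  have hu0 : u ≠ 0 := fun h0 => hu (h0 ▸ Λ.zero_mem)
  set S : Set M := {x : M | x ∈ Λ ∧ x ≠ 0}
  set S' : Set M := {x : M | x - u ∈ Λ ∧ x ≠ u}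
  have hS : LocFinite S := hΛ.mono fun x hx => hx.1
  have hS' : LocFinite S' := (hΛ.coset u).mono fun x hx => hx.1
  have hsplit : {x : M | x - u ∈ Λ} = {u} ∪ S' := by
    ext x
    by_cases hx : x = u <;> simp [hx, S']
  have hsing : canonProd {u} w = 1 - w / u := by
    exact tprod_singleton u fun x : M => 1 - w / x
  have hsingLF : LocFinite ({u} : Set M) := fun B =>
    (Set.finite_singleton u).subset fun x hx => hx.1
  rw [hsplit, canonProd_union hsingLF hS' (Set.disjoint_singleton_left.2 fun h => h.2 rfl), hsing,
    latExp_eq_mul_canonProd, latExp_eq_mul_canonProd]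
  let e : S ≃ S' := (Equiv.subLeft u).subtypeEquiv fun x => by
    simp [S, S', Equiv.subLeft]
  have he : ∀ x : S, (e x : M) = u - x := fun x => rfl
  have hmul : canonProd S (u - w) = canonProd S u * canonProd S' w := by
    have h1 : canonProd S' w = ∏' x : S, (1 - w / (e x : M)) :=
      (e.tprod_eq fun x : S' => 1 - w / (x : M)).symm
    have h2 : Multipliable fun x : S => 1 - w / (e x : M) :=
      e.multipliable_iff.2 (hS'.multipliable w)
    rw [h1, canonProd, canonProd, ← (hS.multipliable u).tprod_mul h2]
    refine tprod_congr fun x => ?_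
    have hx0 : (x : M) ≠ 0 := x.2.2
    have hx1 : u - (x : M) ≠ 0 := fun h => hu (by rw [sub_eq_zero.1 h]; exact x.2.1)
    rw [he]
    field_simp
    ring
  change (u - w) * canonProd S (u - w) = u * canonProd S u * _
  rw [hmul]
  field_simp

theorem latExp_add_mem (hΛ : LocFinite (Λ : Set M)) {u m : M} (hu : u ∉ Λ) (hm : m ∈ Λ) :
    latExp Λ (u + m) = latExp Λ u := by
  have h := latExp_sub hΛ hu (-m)
  rw [sub_neg_eq_add, canonProd_add_invariant (hΛ.coset u), mul_one] at h
  · exact h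
  · intro h0
    rw [Set.mem_ofPred_eq, zero_sub, neg_mem_iff] at h0
    exact hu h0
  · intro x
    rw [Set.mem_ofPred_eq, Set.mem_ofPred_eq, add_sub_right_comm, Λ.add_mem_iff_left hm]

theorem IsRepSet.prod_latExp_eq (hΛ : LocFinite (Λ : Set M)) {R R' : Finset M}
    (h : IsRepSet Λ Λ' R) (h' : IsRepSet Λ Λ' R') (h0 : (0 : M) ∈ R) (h0' : (0 : M) ∈ R') :
    ∏ w ∈ R.erase 0, latExp Λ w = ∏ w ∈ R'.erase 0, latExp Λ w := by
  have key : ∀ w ∈ R.erase 0, ∃ w' ∈ R'.erase 0, w - w' ∈ Λ := fun w hw => by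
    obtain ⟨w', ⟨hw', hsub⟩, -⟩ := h'.2 w (h.1 w (Finset.mem_of_mem_erase hw))
    refine ⟨w', Finset.mem_erase.2 ⟨?_, hw'⟩, hsub⟩
    rintro rfl
    exact h.notMem_of_mem_erase h0 hw (by simpa using hsub)
  choose! g hg hsub using key
  refine Finset.prod_bij (fun w _ => g w) (fun w hw => hg w hw) (fun a ha b hb hab => ?_)
    (fun w' hw' => ?_) fun w hw => ?_
  · refine h.eq_of_sub_mem (Finset.mem_of_mem_erase ha) (Finset.mem_of_mem_erase hb) ?_
    have := Λ.sub_mem (hsub a ha) (hsub b hb)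
    rwa [hab, sub_sub_sub_cancel_right] at this
  · obtain ⟨w, ⟨hw, hs⟩, -⟩ := h.2 w' (h'.1 w' (Finset.mem_of_mem_erase hw'))
    have hw1 : w ∈ R.erase 0 := by
      refine Finset.mem_erase.2 ⟨?_, hw⟩
      rintro rfl
      exact h'.notMem_of_mem_erase h0' hw' (by simpa using hs)
    refine ⟨w, hw1, (h'.eq_of_sub_mem (Finset.mem_of_mem_erase hw')
      (Finset.mem_of_mem_erase (hg w hw1)) ?_).symm⟩
    have := Λ.add_mem hs (hsub w hw1)
    rwa [sub_add_sub_cancel] at this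
  · have h1 := latExp_add_mem hΛ (h'.notMem_of_mem_erase h0' (hg w hw)) (hsub w hw)
    rwa [add_sub_cancel] at h1

theorem IsRepSet.latDisc_eq (hΛ : LocFinite (Λ : Set M)) {R : Finset M}
    (h : IsRepSet Λ Λ' R) (h0 : (0 : M) ∈ R) :
    latDisc Λ Λ' = (∏ w ∈ R.erase 0, latExp Λ w)⁻¹ := by
  have hex : ∃ R : Finset M, IsRepSet Λ Λ' R ∧ (0 : M) ∈ R := ⟨R, h, h0⟩
  rw [latDisc, dif_pos hex,
    IsRepSet.prod_latExp_eq hΛ hex.choose_spec.1 h hex.choose_spec.2 h0]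

/-- The lattices `Λ' i` between `Λ` and `n⁻¹Λ`, if they cover `n⁻¹Λ` and meet pairwise in `Λ`,
have `t`-division products multiplying up to a power of the one of `Λ`. -/
theorem prod_prod_latExp {ι : Type*} (s : Finset ι) {P : ι → Submodule (Polynomial F) M}
    {Γ : Submodule (Polynomial F) M} (hΓ : LocFinite (Γ : Set M)) (hnt : IsCoprime n t)
    (ht : algebraMap (Polynomial F) M t ≠ 0) (hn : algebraMap (Polynomial F) M n ≠ 0)
    (hnΓ : ∀ x, x ∈ Γ ↔ n • x ∈ Λ) (hle : ∀ i ∈ s, Λ ≤ P i) (hle' : ∀ i ∈ s, P i ≤ Γ)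
    (hcover : ∀ x ∈ Γ, x ∉ Λ → ∃ i ∈ s, x ∈ P i)
    (hdisj : ∀ i ∈ s, ∀ j ∈ s, i ≠ j → ∀ x ∈ P i, x ∈ P j → x ∈ Λ) {R : Finset M}
    (h : IsRepSet Λ (scaleSub (algebraMap (Polynomial F) M t)⁻¹ Λ) R) (h0 : (0 : M) ∈ R) :
    algebraMap (Polynomial F) M n ^ (R.erase 0).card *
      ∏ i ∈ s, ∏ w ∈ R.erase 0, latExp (P i) w = (∏ w ∈ R.erase 0, latExp Λ w) ^ s.card := by
  have hΛΓ : Λ ≤ Γ := fun x hx => (hnΓ x).2 (Λ.smul_mem n hx)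
  have hΛ : LocFinite (Λ : Set M) := hΓ.mono hΛΓ
  have hunion : (Γ : Set M) \ Λ = ⋃ i ∈ s, ((P i : Set M) \ Λ) := by
    ext x
    simp only [Set.mem_sdiff, SetLike.mem_coe, Set.mem_iUnion, exists_prop]
    constructor
    · rintro ⟨hx, hx'⟩
      obtain ⟨i, hi, hxi⟩ := hcover x hx hx'
      exact ⟨i, hi, hxi, hx'⟩
    · rintro ⟨i, hi, hxi, hx'⟩
      exact ⟨hle' i hi hxi, hx'⟩
  have hprod : ∀ w, canonProd ((Γ : Set M) \ Λ) w =
      ∏ i ∈ s, canonProd ((P i : Set M) \ Λ) w := fun w => by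
    rw [hunion]
    refine canonProd_biUnion s (fun i hi => hΓ.mono fun x hx => hle' i hi hx.1) ?_ w
    intro i hi j hj hij
    exact Set.disjoint_left.2 fun x hx hx' => hx.2 (hdisj i hi j hj hij x hx.1 hx'.1)
  have hΓexp : ∀ w, algebraMap (Polynomial F) M n * latExp Γ w =
      latExp Λ (algebraMap (Polynomial F) M n * w) := fun w =>
    (latExp_mul_left hn (fun x => by rw [hnΓ, Algebra.smul_def]) w).symm
  have hperm : ∏ w ∈ R.erase 0, latExp Λ (algebraMap (Polynomial F) M n * w) =
      ∏ w ∈ R.erase 0, latExp Λ w := by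
    rw [← prod_erase_image_mul_left hn R]
    exact (h.image_smul hnt ht).prod_latExp_eq hΛ h
      (Finset.mem_image.2 ⟨0, h0, mul_zero _⟩) h0
  have hne : ∏ w ∈ R.erase 0, latExp Λ w ≠ 0 := Finset.prod_ne_zero_iff.2 fun w hw =>
    latExp_ne_zero hΛ (h.notMem_of_mem_erase h0 hw)
  have hD : algebraMap (Polynomial F) M n ^ (R.erase 0).card *
      ∏ w ∈ R.erase 0, canonProd ((Γ : Set M) \ Λ) w = 1 := by
    refine mul_left_cancel₀ hne ?_
    rw [mul_one]
    nth_rewrite 2 [← hperm]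
    simp_rw [← hΓexp, latExp_eq_mul_of_le hΛΓ hΓ]
    rw [Finset.prod_mul_distrib, Finset.prod_mul_distrib, Finset.prod_const]
    ring
  have hfac : ∏ i ∈ s, ∏ w ∈ R.erase 0, latExp (P i) w =
      (∏ w ∈ R.erase 0, latExp Λ w) ^ s.card *
        ∏ w ∈ R.erase 0, canonProd ((Γ : Set M) \ Λ) w := by
    rw [← Finset.prod_const, Finset.prod_congr rfl fun w _ => hprod w,
      Finset.prod_comm (s := R.erase 0),
      ← Finset.prod_mul_distrib]
    refine Finset.prod_congr rfl fun i hi => ?_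
    rw [← Finset.prod_mul_distrib]
    exact Finset.prod_congr rfl fun w _ =>
      latExp_eq_mul_of_le (hle i hi) (hΓ.mono (hle' i hi)) w
  rw [hfac, mul_left_comm, hD, mul_one]

end Lattices
section RankTwo

open Polynomial in
theorem ncard_degree_lt (F : Type*) [Field F] [Fintype F] (N : ℕ) :
    {a : F[X] | a.degree < N}.ncard = Fintype.card F ^ N := by
  have h : {a : F[X] | a.degree < N} = (Polynomial.degreeLT F N : Set F[X]) := by
    ext a
    simp [Polynomial.mem_degreeLT]
  rw [h, ← Nat.card_coe_set_eq]
  change Nat.card (Polynomial.degreeLT F N) = _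
  rw [Nat.card_congr (Polynomial.degreeLTEquiv F N).toEquiv]
  simp

theorem finite_degree_lt (F : Type*) [Field F] [Fintype F] (N : ℕ) :
    {a : Polynomial F | a.degree < N}.Finite := by
  refine Set.finite_of_ncard_ne_zero ?_
  rw [ncard_degree_lt]
  exact pow_ne_zero _ Fintype.card_ne_zero

variable {F : Type*} [Field F] {M : Type*} [NormedField M] [Algebra (Polynomial F) M] {ω : M}

theorem mem_lat2 {x : M} : x ∈ lat2 (Fq := F) ω ↔
    ∃ b c, algebraMap (Polynomial F) M b * ω + algebraMap (Polynomial F) M c = x := by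
  simp [lat2, Submodule.mem_span_pair, Algebra.smul_def]

theorem mul_add_eq_zero_of_notMem_Kinfty
    (hinj : Function.Injective (algebraMap (Polynomial F) M))
    (hω : ω ∉ Kinfty (Fq := F) (L := M)) {b c : Polynomial F}
    (h : algebraMap (Polynomial F) M b * ω + algebraMap (Polynomial F) M c = 0) :
    b = 0 ∧ c = 0 := by
  have hb : b = 0 := by
    by_contra hb
    refine hω (subset_closure ?_)
    have hb' : algebraMap (Polynomial F) M b ≠ 0 := (map_ne_zero_iff _ hinj).2 hb
    have : ω = -algebraMap (Polynomial F) M c / algebraMap (Polynomial F) M b := by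
      rw [eq_div_iff hb']
      linear_combination h
    rw [this]
    exact div_mem (neg_mem (Subfield.subset_closure ⟨c, rfl⟩)) (Subfield.subset_closure ⟨b, rfl⟩)
  subst hb
  refine ⟨rfl, (map_eq_zero_iff _ hinj).1 ?_⟩
  simpa using h

theorem mul_add_injective
    (hind : ∀ b c, algebraMap (Polynomial F) M b * ω + algebraMap (Polynomial F) M c = 0 →
      b = 0 ∧ c = 0) {b c b' c' : Polynomial F}
    (h : algebraMap (Polynomial F) M b * ω + algebraMap (Polynomial F) M c =
      algebraMap (Polynomial F) M b' * ω + algebraMap (Polynomial F) M c') :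
    b = b' ∧ c = c' := by
  have := hind (b - b') (c - c') (by rw [map_sub, map_sub]; linear_combination h)
  exact ⟨sub_eq_zero.1 this.1, sub_eq_zero.1 this.2⟩

theorem finite_norm_algebraMap_le [Fintype F]
    (hA : ∀ a : Polynomial F, a ≠ 0 →
      ‖algebraMap (Polynomial F) M a‖ = (Fintype.card F : ℝ) ^ a.natDegree) (B : ℝ) :
    {a : Polynomial F | ‖algebraMap (Polynomial F) M a‖ ≤ B}.Finite := by
  have hq : (1 : ℝ) < Fintype.card F := by exact_mod_cast Fintype.one_lt_card
  obtain ⟨N, hN⟩ := pow_unbounded_of_one_lt B hq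
  refine (finite_degree_lt F N).subset fun a ha => ?_
  by_cases h0 : a = 0
  · simp [h0]
  · rw [Set.mem_ofPred_eq, hA a h0] at ha
    exact (Polynomial.natDegree_lt_iff_degree_lt h0).1
      ((pow_lt_pow_iff_right₀ hq).1 (ha.trans_lt hN))

theorem locFinite_lat2 [Fintype F]
    (hA : ∀ a : Polynomial F, a ≠ 0 →
      ‖algebraMap (Polynomial F) M a‖ = (Fintype.card F : ℝ) ^ a.natDegree)
    (hω : ω ∉ Kinfty (Fq := F) (L := M)) :
    LocFinite (lat2 (Fq := F) ω : Set M) := by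
  intro B
  obtain ⟨δ, hδ, hdist⟩ : ∃ δ > 0, ∀ y ∈ (Subfield.closure
      (Set.range (algebraMap (Polynomial F) M)) : Subfield M), δ ≤ dist ω y := by
    rw [Kinfty, Metric.mem_closure_iff] at hω
    push Not at hω
    exact hω
  have hnorm : ∀ b c : Polynomial F, ‖algebraMap (Polynomial F) M b * ω +
      algebraMap (Polynomial F) M c‖ ≤ B → ‖algebraMap (Polynomial F) M b‖ ≤ max 0 (B / δ) := by
    intro b c h
    by_cases hb : algebraMap (Polynomial F) M b = 0
    · rw [hb, norm_zero]
      exact le_max_left _ _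
    · refine le_max_of_le_right ?_
      rw [le_div_iff₀ hδ]
      refine le_trans ?_ h
      have h1 := hdist (-algebraMap (Polynomial F) M c / algebraMap (Polynomial F) M b)
        (div_mem (neg_mem (Subfield.subset_closure ⟨c, rfl⟩)) (Subfield.subset_closure ⟨b, rfl⟩))
      have h2 : algebraMap (Polynomial F) M b * ω + algebraMap (Polynomial F) M c =
          algebraMap (Polynomial F) M b *
            (ω - -algebraMap (Polynomial F) M c / algebraMap (Polynomial F) M b) := by
        field_simp
        ring
      rw [h2, norm_mul, ← dist_eq_norm]
      gcongr
  refine (((finite_norm_algebraMap_le hA (max 0 (B / δ))).prod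
    (finite_norm_algebraMap_le hA (B + max 0 (B / δ) * ‖ω‖))).image fun p =>
      algebraMap (Polynomial F) M p.1 * ω + algebraMap (Polynomial F) M p.2).subset ?_
  rintro x ⟨hx, hxB⟩
  obtain ⟨b, c, rfl⟩ := mem_lat2.1 hx
  refine ⟨(b, c), ⟨hnorm b c hxB, ?_⟩, rfl⟩
  have h1 := norm_sub_le (algebraMap (Polynomial F) M b * ω +
      algebraMap (Polynomial F) M c) (algebraMap (Polynomial F) M b * ω)
  rw [add_sub_cancel_left, norm_mul] at h1
  refine h1.trans ?_
  gcongr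
  exact hnorm b c hxB

theorem exists_isRepSet_lat2 [Fintype F]
    (hind : ∀ b c, algebraMap (Polynomial F) M b * ω + algebraMap (Polynomial F) M c = 0 →
      b = 0 ∧ c = 0) (hX : algebraMap (Polynomial F) M Polynomial.X ≠ 0) :
    ∃ R : Finset M, IsRepSet (lat2 (Fq := F) ω)
      (scaleSub (algebraMap (Polynomial F) M Polynomial.X)⁻¹ (lat2 (Fq := F) ω)) R ∧
      (0 : M) ∈ R := by
  let g : F × F → M := fun p => (algebraMap (Polynomial F) M Polynomial.X)⁻¹ *
    (algebraMap (Polynomial F) M (Polynomial.C p.1) * ω +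
      algebraMap (Polynomial F) M (Polynomial.C p.2))
  have hg : ∀ p, algebraMap (Polynomial F) M Polynomial.X * g p =
      algebraMap (Polynomial F) M (Polynomial.C p.1) * ω +
        algebraMap (Polynomial F) M (Polynomial.C p.2) := fun p => mul_inv_cancel_left₀ hX _
  refine ⟨Finset.univ.image g, ⟨fun w hw => ?_, fun y hy => ?_⟩,
    Finset.mem_image.2 ⟨0, Finset.mem_univ _, by simp [g]⟩⟩
  · obtain ⟨p, -, rfl⟩ := Finset.mem_image.1 hw
    rw [mem_scaleSub_inv hX, Algebra.smul_def, hg]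
    exact mem_lat2.2 ⟨_, _, rfl⟩
  · rw [mem_scaleSub_inv hX, Algebra.smul_def] at hy
    obtain ⟨b, c, hbc⟩ := mem_lat2.1 hy
    have hsub : y - g (b.coeff 0, c.coeff 0) ∈ lat2 (Fq := F) ω := by
      refine mem_lat2.2 ⟨b.divX, c.divX, mul_left_cancel₀ hX ?_⟩
      rw [mul_sub, ← hbc, hg]
      nth_rewrite 2 [← Polynomial.divX_mul_X_add b]
      nth_rewrite 2 [← Polynomial.divX_mul_X_add c]
      simp only [map_add, map_mul]
      ring
    refine ⟨g (b.coeff 0, c.coeff 0), ⟨Finset.mem_image_of_mem _ (Finset.mem_univ _), hsub⟩, ?_⟩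
    rintro _ ⟨hw, hs⟩
    obtain ⟨p, -, rfl⟩ := Finset.mem_image.1 hw
    have hdiff := Submodule.sub_mem _ hs hsub
    rw [sub_sub_sub_cancel_left] at hdiff
    obtain ⟨b', c', hbc'⟩ := mem_lat2.1 hdiff
    have heq : algebraMap (Polynomial F) M (Polynomial.X * b' + Polynomial.C p.1) * ω +
        algebraMap (Polynomial F) M (Polynomial.X * c' + Polynomial.C p.2) =
        algebraMap (Polynomial F) M (Polynomial.C (b.coeff 0)) * ω +
          algebraMap (Polynomial F) M (Polynomial.C (c.coeff 0)) := by
      rw [← hg (b.coeff 0, c.coeff 0)]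
      simp only [map_add, map_mul]
      linear_combination (algebraMap (Polynomial F) M Polynomial.X) * hbc' - hg p
    obtain ⟨h1, h2⟩ := mul_add_injective hind heq
    have h3 := congrArg (Polynomial.coeff · 0) h1
    have h4 := congrArg (Polynomial.coeff · 0) h2
    simp at h3 h4
    rw [← h3, ← h4]

variable {n : Polynomial F} {x : M} {b c : Polynomial F}

theorem mem_lat2_iff_dvd
    (hind : ∀ b c, algebraMap (Polynomial F) M b * ω + algebraMap (Polynomial F) M c = 0 →
      b = 0 ∧ c = 0) (hn : algebraMap (Polynomial F) M n ≠ 0)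
    (hx : algebraMap (Polynomial F) M b * ω + algebraMap (Polynomial F) M c =
      algebraMap (Polynomial F) M n * x) :
    x ∈ lat2 (Fq := F) ω ↔ n ∣ b ∧ n ∣ c := by
  rw [mem_lat2]
  constructor
  · rintro ⟨b', c', rfl⟩
    obtain ⟨rfl, rfl⟩ := mul_add_injective hind (b' := n * b') (c' := n * c') (by
      rw [hx, map_mul, map_mul]; ring)
    exact ⟨dvd_mul_right _ _, dvd_mul_right _ _⟩
  · rintro ⟨⟨b', rfl⟩, ⟨c', rfl⟩⟩
    refine ⟨b', c', mul_left_cancel₀ hn ?_⟩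
    rw [← hx, map_mul, map_mul]
    ring

theorem mem_scaleSub_inv_lat2_mul_iff_dvd
    (hind : ∀ b c, algebraMap (Polynomial F) M b * ω + algebraMap (Polynomial F) M c = 0 →
      b = 0 ∧ c = 0) (hn : algebraMap (Polynomial F) M n ≠ 0)
    (hx : algebraMap (Polynomial F) M b * ω + algebraMap (Polynomial F) M c =
      algebraMap (Polynomial F) M n * x) :
    x ∈ scaleSub (algebraMap (Polynomial F) M n)⁻¹
      (lat2 (Fq := F) (algebraMap (Polynomial F) M n * ω)) ↔ n ∣ b := by
  rw [mem_scaleSub_inv hn, Algebra.smul_def, ← hx, mem_lat2]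
  constructor
  · rintro ⟨b', c', h⟩
    obtain ⟨rfl, -⟩ := mul_add_injective hind (b := b) (b' := n * b') (c' := c') (by
      rw [← h, map_mul]; ring)
    exact dvd_mul_right _ _
  · rintro ⟨b', rfl⟩
    exact ⟨b', c, by rw [map_mul]; ring⟩

theorem mem_lat2_div_iff_dvd
    (hind : ∀ b c, algebraMap (Polynomial F) M b * ω + algebraMap (Polynomial F) M c = 0 →
      b = 0 ∧ c = 0) (hn : algebraMap (Polynomial F) M n ≠ 0)
    (hx : algebraMap (Polynomial F) M b * ω + algebraMap (Polynomial F) M c =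
      algebraMap (Polynomial F) M n * x) (a : Polynomial F) :
    x ∈ lat2 (Fq := F)
      ((ω + algebraMap (Polynomial F) M a) / algebraMap (Polynomial F) M n) ↔ n ∣ c - b * a := by
  rw [mem_lat2]
  constructor
  · rintro ⟨b', c', rfl⟩
    obtain ⟨rfl, rfl⟩ := mul_add_injective hind (b := b) (b' := b') (c' := b' * a + n * c') (by
      rw [hx, map_add, map_mul, map_mul]; field_simp; ring)
    rw [add_sub_cancel_left]
    exact dvd_mul_right _ _
  · rintro ⟨c', hc'⟩
    obtain rfl : c = b * a + n * c' := by rw [← hc']; ring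
    refine ⟨b, c', mul_left_cancel₀ hn ?_⟩
    rw [← hx, map_add, map_mul, map_mul]
    field_simp
    ring

/-- The superlattices of `A·ω + A` of index `n`: `A·ω + n⁻¹·A`, and
`A·(ω + a)/n + A` for polynomials `a`. -/
def indexLat (ω : M) (n : Polynomial F) : Option (Polynomial F) → Submodule (Polynomial F) M
  | none => scaleSub (algebraMap (Polynomial F) M n)⁻¹
      (lat2 (Fq := F) (algebraMap (Polynomial F) M n * ω))
  | some a => lat2 (Fq := F)
      ((ω + algebraMap (Polynomial F) M a) / algebraMap (Polynomial F) M n)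

theorem exists_coord_of_mem_scaleSub_inv_lat2 (hn : algebraMap (Polynomial F) M n ≠ 0)
    (hx : x ∈ scaleSub (algebraMap (Polynomial F) M n)⁻¹ (lat2 (Fq := F) ω)) :
    ∃ b c, algebraMap (Polynomial F) M b * ω + algebraMap (Polynomial F) M c =
      algebraMap (Polynomial F) M n * x := by
  rwa [mem_scaleSub_inv hn, Algebra.smul_def, mem_lat2] at hx

theorem lat2_le_indexLat
    (hind : ∀ b c, algebraMap (Polynomial F) M b * ω + algebraMap (Polynomial F) M c = 0 →
      b = 0 ∧ c = 0) (hn : algebraMap (Polynomial F) M n ≠ 0) (o : Option (Polynomial F)) :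
    lat2 (Fq := F) ω ≤ indexLat ω n o := by
  intro x hx
  obtain ⟨b, c, hbc⟩ := exists_coord_of_mem_scaleSub_inv_lat2 (n := n) hn
    ((mem_scaleSub_inv hn).2 (Submodule.smul_mem _ n hx))
  obtain ⟨h1, h2⟩ := (mem_lat2_iff_dvd hind hn hbc).1 hx
  cases o with
  | none => exact (mem_scaleSub_inv_lat2_mul_iff_dvd hind hn hbc).2 h1
  | some a => exact (mem_lat2_div_iff_dvd hind hn hbc a).2 (dvd_sub h2 (h1.mul_right a))

theorem indexLat_le (hn : algebraMap (Polynomial F) M n ≠ 0) (o : Option (Polynomial F)) :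
    indexLat ω n o ≤ scaleSub (algebraMap (Polynomial F) M n)⁻¹ (lat2 (Fq := F) ω) := by
  intro x hx
  rw [mem_scaleSub_inv hn, mem_lat2, Algebra.smul_def]
  cases o with
  | none =>
    rw [indexLat, mem_scaleSub_inv hn, mem_lat2, Algebra.smul_def] at hx
    obtain ⟨b, c, hbc⟩ := hx
    exact ⟨b * n, c, by rw [← hbc, map_mul]; ring⟩
  | some a =>
    obtain ⟨b, c, rfl⟩ := mem_lat2.1 hx
    refine ⟨b, b * a + n * c, ?_⟩
    rw [map_add, map_mul, map_mul]
    field_simp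
    ring

theorem exists_mem_indexLat
    (hind : ∀ b c, algebraMap (Polynomial F) M b * ω + algebraMap (Polynomial F) M c = 0 →
      b = 0 ∧ c = 0) (hn : algebraMap (Polynomial F) M n ≠ 0) (hmon : n.Monic)
    (hirr : Irreducible n)
    (hx : x ∈ scaleSub (algebraMap (Polynomial F) M n)⁻¹ (lat2 (Fq := F) ω)) :
    ∃ o : Option (Polynomial F), (∀ a ∈ o, a.degree < n.degree) ∧ x ∈ indexLat ω n o := by
  obtain ⟨b, c, hbc⟩ := exists_coord_of_mem_scaleSub_inv_lat2 hn hx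
  by_cases hb : n ∣ b
  · exact ⟨none, by simp, (mem_scaleSub_inv_lat2_mul_iff_dvd hind hn hbc).2 hb⟩
  · obtain ⟨u, v, huv⟩ := (hirr.coprime_iff_not_dvd).2 hb
    refine ⟨some ((v * c) %ₘ n), ?_, (mem_lat2_div_iff_dvd hind hn hbc _).2 ?_⟩
    · rintro a ⟨⟩
      exact Polynomial.degree_modByMonic_lt _ hmon
    · refine ⟨u * c + b * ((v * c) /ₘ n), ?_⟩
      linear_combination c * huv.symm - b * Polynomial.modByMonic_add_div (v * c) n

theorem mem_lat2_of_mem_indexLat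
    (hind : ∀ b c, algebraMap (Polynomial F) M b * ω + algebraMap (Polynomial F) M c = 0 →
      b = 0 ∧ c = 0) (hn : algebraMap (Polynomial F) M n ≠ 0) (hirr : Irreducible n)
    {o o' : Option (Polynomial F)} (ho : ∀ a ∈ o, a.degree < n.degree)
    (ho' : ∀ a ∈ o', a.degree < n.degree) (hne : o ≠ o') (hx : x ∈ indexLat ω n o)
    (hx' : x ∈ indexLat ω n o') : x ∈ lat2 (Fq := F) ω := by
  obtain ⟨b, c, hbc⟩ := exists_coord_of_mem_scaleSub_inv_lat2 hn (indexLat_le hn o hx)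
  rw [mem_lat2_iff_dvd hind hn hbc]
  have hsome : ∀ a, n ∣ b → x ∈ indexLat ω n (some a) → n ∣ b ∧ n ∣ c := fun a hb ha =>
    ⟨hb, (dvd_sub_left (hb.mul_right a)).1 ((mem_lat2_div_iff_dvd hind hn hbc a).1 ha)⟩
  have hnone : x ∈ indexLat ω n none → n ∣ b := (mem_scaleSub_inv_lat2_mul_iff_dvd hind hn hbc).1
  match o, o' with
  | none, none => exact absurd rfl hne
  | none, some a => exact hsome a (hnone hx) hx'
  | some a, none => exact hsome a (hnone hx') hx
  | some a, some a' =>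
    refine hsome a ?_ hx
    have h1 := dvd_sub ((mem_lat2_div_iff_dvd hind hn hbc a').1 hx')
      ((mem_lat2_div_iff_dvd hind hn hbc a).1 hx)
    rw [sub_sub_sub_cancel_left, ← mul_sub] at h1
    refine (hirr.prime.dvd_or_dvd h1).resolve_right fun h2 => ?_
    refine Polynomial.not_dvd_of_degree_lt (sub_ne_zero.2 fun h => hne (congrArg some h)) ?_ h2
    exact (Polynomial.degree_sub_le _ _).trans_lt (max_lt (ho a rfl) (ho' a' rfl))

end RankTwo

/-- The functional equation
`Δ(ω)^{q^d+1} = Δ(nω)·∏_{a ∈ A, deg a < d} Δ((ω+a)/n)` for every `ω ∈ L ∖ K_∞` and every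
monic irreducible `n ∈ A = 𝔽_q[T]` of degree `d` with `n ≠ T`. -/
theorem statement5
    (q : ℕ) (hq : Fintype.card Fq = q)
    (hna : ∀ x y : L, ‖x + y‖ ≤ max ‖x‖ ‖y‖)
    (hA : ∀ a : Polynomial Fq, a ≠ 0 →
      ‖algebraMap (Polynomial Fq) L a‖ = (q : ℝ) ^ a.natDegree)
    (hval : ∀ x : L, x ≠ 0 → ∃ s : ℚ, ‖x‖ = (q : ℝ) ^ (s : ℝ))
    (ω : L) (hω : ω ∉ Kinfty (Fq := Fq) (L := L))
    (n : Polynomial Fq) (hmon : n.Monic) (hirr : Irreducible n) (hn : n ≠ Polynomial.X)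
    (d : ℕ) (hd : n.natDegree = d) :
    Dfun (Fq := Fq) ω ^ (q ^ d + 1) =
      Dfun (Fq := Fq) (algebraMap (Polynomial Fq) L n * ω) *
        ∏ᶠ (a : Polynomial Fq) (_ : a.degree < (d : WithBot ℕ)),
          Dfun (Fq := Fq)
            ((ω + algebraMap (Polynomial Fq) L a) / algebraMap (Polynomial Fq) L n) := by
  subst hq hd
  have : IsUltrametricDist L :=
    IsUltrametricDist.isUltrametricDist_of_forall_norm_add_le_max_norm hna
  have hne : ∀ a : Polynomial Fq, a ≠ 0 → algebraMap (Polynomial Fq) L a ≠ 0 := fun a ha => by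
    rw [← norm_pos_iff, hA a ha]
    exact pow_pos (by exact_mod_cast Fintype.card_pos) _
  have hinj : Function.Injective (algebraMap (Polynomial Fq) L) :=
    (injective_iff_map_eq_zero _).2 fun a ha => by
      by_contra h
      exact hne a h ha
  have hN := hne n hmon.ne_zero
  have hX := hne Polynomial.X Polynomial.X_ne_zero
  have hind : ∀ b c, algebraMap (Polynomial Fq) L b * ω + algebraMap (Polynomial Fq) L c = 0 →
      b = 0 ∧ c = 0 := fun b c => mul_add_eq_zero_of_notMem_Kinfty hinj hω
  have hcop : IsCoprime n Polynomial.X := by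
    rw [hirr.coprime_iff_not_dvd, hirr.dvd_irreducible_iff_associated Polynomial.irreducible_X]
    exact fun h => hn (Polynomial.eq_of_monic_of_associated hmon Polynomial.monic_X h)
  set Λ : Submodule (Polynomial Fq) L := lat2 ω
  set Γ : Submodule (Polynomial Fq) L := scaleSub (algebraMap (Polynomial Fq) L n)⁻¹ Λ
  have hΛ : LocFinite (Λ : Set L) := locFinite_lat2 hA hω
  have hΓ : LocFinite (Γ : Set L) := hΛ.of_mul_left hN fun x hx => by
    rwa [SetLike.mem_coe, mem_scaleSub_inv hN, Algebra.smul_def] at hx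
  obtain ⟨R, hR, hR0⟩ := exists_isRepSet_lat2 hind hX
  have hs := finite_degree_lt Fq n.natDegree
  set s := hs.toFinset
  have hcard : s.card = Fintype.card Fq ^ n.natDegree := by
    rw [← ncard_degree_lt, Set.ncard_eq_toFinset_card _ hs]
  have hdeg : ∀ o ∈ s.insertNone, ∀ a ∈ o, a.degree < n.degree := fun o ho a ha => by
    have := Finset.mem_insertNone.1 ho a ha
    rwa [Set.Finite.mem_toFinset, Set.mem_ofPred_eq,
      ← Polynomial.degree_eq_natDegree hmon.ne_zero] at this
  have hmain := prod_prod_latExp s.insertNone (P := indexLat ω n) hΓ hcop hX hN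
    (fun x => mem_scaleSub_inv hN) (fun o _ => lat2_le_indexLat hind hN o)
    (fun o _ => indexLat_le hN o)
    (fun x hx _ => by
      obtain ⟨o, ho, hxo⟩ := exists_mem_indexLat hind hN hmon hirr hx
      refine ⟨o, Finset.mem_insertNone.2 fun a ha => ?_, hxo⟩
      rw [Set.Finite.mem_toFinset, Set.mem_ofPred_eq,
        ← Polynomial.degree_eq_natDegree hmon.ne_zero]
      exact ho a ha)
    (fun o ho o' ho' hoo' x hx hx' =>
      mem_lat2_of_mem_indexLat hind hN hirr (hdeg o ho) (hdeg o' ho') hoo' hx hx') hR hR0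
  have hPR : ∀ o, IsRepSet (indexLat ω n o)
      (scaleSub (algebraMap (Polynomial Fq) L Polynomial.X)⁻¹ (indexLat ω n o)) R := fun o =>
    hR.of_le_of_smul_mem hcop hX (lat2_le_indexLat hind hN o) fun x hx =>
      (mem_scaleSub_inv hN).1 (indexLat_le hN o hx)
  have hP : ∀ o, LocFinite (indexLat ω n o : Set L) := fun o => hΓ.mono (indexLat_le hN o)
  have hD : Dfun (Fq := Fq) ω = algebraMap (Polynomial Fq) L Polynomial.X *
      (∏ w ∈ R.erase 0, latExp Λ w)⁻¹ := by
    rw [Dfun, hR.latDisc_eq hΛ hR0]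
  have hDsome : ∀ a, Dfun (Fq := Fq)
      ((ω + algebraMap (Polynomial Fq) L a) / algebraMap (Polynomial Fq) L n) =
      algebraMap (Polynomial Fq) L Polynomial.X *
        (∏ w ∈ R.erase 0, latExp (indexLat ω n (some a)) w)⁻¹ := fun a => by
    rw [Dfun, ← (hPR (some a)).latDisc_eq (hP (some a)) hR0]
    rfl
  have hDnone : Dfun (Fq := Fq) (algebraMap (Polynomial Fq) L n * ω) =
      algebraMap (Polynomial Fq) L Polynomial.X *
        (algebraMap (Polynomial Fq) L n ^ (R.erase 0).card *
          ∏ w ∈ R.erase 0, latExp (indexLat ω n none) w)⁻¹ := by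
    have hmem : ∀ x, x ∈ indexLat ω n none ↔ algebraMap (Polynomial Fq) L n * x ∈
        lat2 (Fq := Fq) (algebraMap (Polynomial Fq) L n * ω) := fun x => by
      rw [indexLat, mem_scaleSub_inv hN, Algebra.smul_def]
    have hrep := (hPR none).image_mul_left hN hmem
      (Γ' := scaleSub (algebraMap (Polynomial Fq) L Polynomial.X)⁻¹
        (lat2 (Fq := Fq) (algebraMap (Polynomial Fq) L n * ω))) fun x => by
        rw [mem_scaleSub_inv hX, mem_scaleSub_inv hX, hmem, Algebra.smul_def, Algebra.smul_def,
          mul_left_comm]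
    have hlf : LocFinite (lat2 (Fq := Fq) (algebraMap (Polynomial Fq) L n * ω) : Set L) :=
      (hP none).of_mul_left (inv_ne_zero hN) fun x hx => by
        rwa [SetLike.mem_coe, hmem, mul_inv_cancel_left₀ hN]
    rw [Dfun, hrep.latDisc_eq hlf (Finset.mem_image.2 ⟨0, hR0, mul_zero _⟩),
      prod_erase_image_mul_left hN, Finset.prod_congr rfl fun w _ => latExp_mul_left hN hmem w,
      Finset.prod_mul_distrib, Finset.prod_const]
  have hfin : ∏ᶠ (a : Polynomial Fq) (_ : a.degree < (n.natDegree : WithBot ℕ)),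
      Dfun (Fq := Fq) ((ω + algebraMap (Polynomial Fq) L a) / algebraMap (Polynomial Fq) L n) =
      ∏ a ∈ s, Dfun (Fq := Fq)
        ((ω + algebraMap (Polynomial Fq) L a) / algebraMap (Polynomial Fq) L n) :=
    finprod_mem_eq_finite_toFinset_prod _ hs
  rw [hfin, Finset.prod_congr rfl fun a _ => hDsome a, hDnone, hD, Finset.prod_mul_distrib,
    Finset.prod_const, hcard, mul_pow, inv_pow]
  rw [Finset.card_insertNone, hcard, Finset.prod_insertNone] at hmain
  rw [← hmain, Finset.prod_inv_distrib, mul_inv, mul_inv, mul_inv]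
  ring
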